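/- arXiv:2302.09672 — 2 statements merged into one kernel-verified Lean document; each statement's English description precedes it below -/
import Mathlib

section
/- Let n ≥ 2 be an integer and let d, d₁, d₂, d₃ be positive integers with d₁, d₂, d₃ ≤ n+2-d and d₁ + d₂ + d₃ ≥ n + 2 - d. Then the polytope U(n,d,d₁,d₂,d₃) ⊆ ℝ³ equals the convex hull of the ten points (0,0,0), (((n+1)d₁-(n+2-d))/(n d₁),0,0), (0,((n+1)d₂-(n+2-d))/(n d₂),0), (0,0,((n+1)d₃-(n+2-d))/(n d₃)), A₁, B₁, A₂, B₂, A₃, B₃, where: if d₂+d₃ ≥ n+2-d then A₁ = (0, 1, (n+2-d-d₂)/d₃) and B₁ = (0, (n+2-d-d₃)/d₂, 1), while if d₂+d₃ ≤ n+2-d then A₁ = (0, (d₃+n d₂-(n+2-d))/((n-1)d₂), (d₂+n d₃-(n+2-d))/((n-1)d₃)) and B₁ = ((n+2-d-(d₂+d₃))/d₁, 1, 1); if d₁+d₃ ≥ n+2-d then A₂ = (1, 0, (n+2-d-d₁)/d₃) and B₂ = ((n+2-d-d₃)/d₁, 0, 1), while if d₁+d₃ ≤ n+2-d then A₂ = ((d₃+n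 d₁-(n+2-d))/((n-1)d₁), 0, (d₁+n d₃-(n+2-d))/((n-1)d₃)) and B₂ = (1, (n+2-d-(d₁+d₃))/d₂, 1); if d₁+d₂ ≥ n+2-d then A₃ = (1, (n+2-d-d₁)/d₂, 0) and B₃ = ((n+2-d-d₂)/d₁, 1, 0), while if d₁+d₂ ≤ n+2-d then A₃ = ((d₂+n d₁-(n+2-d))/((n-1)d₁), (d₁+n d₂-(n+2-d))/((n-1)d₂), 0) and B₃ = (1, 1, (n+2-d-(d₁+d₂))/d₃). (In the boundary cases where a pairwise sum equals n+2-d, the two descriptions of A_i, B_i agree.) -/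
/-- At an extreme point of a polyhedron, the linear parts of the active constraints have trivial
common kernel. -/
theorem eq_zero_of_mem_extremePoints_polyhedron {E ι : Type*} [AddCommGroup E] [Module ℝ E]
    [Finite ι] (l : ι → E →ₗ[ℝ] ℝ) (k : ι → ℝ) {x : E}
    (hx : x ∈ Set.extremePoints ℝ {x : E | ∀ i, 0 ≤ l i x + k i}) {v : E}
    (hv : ∀ i, l i x + k i = 0 → l i v = 0) : v = 0 := by
  have hx0 : ∀ i, 0 ≤ l i x + k i := hx.1
  have hε : ∀ i, ∀ᶠ ε in nhdsWithin (0 : ℝ) (Set.Ioi 0), ε * |l i v| ≤ l i x + k i := by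
    intro i
    rcases (hx0 i).eq_or_lt with h | h
    · simp [hv i h.symm, ← h]
    · have ht : Filter.Tendsto (fun ε : ℝ => ε * |l i v|) (nhdsWithin 0 (Set.Ioi 0)) (nhds 0) :=
        tendsto_nhdsWithin_of_tendsto_nhds (by
          have hcont : Continuous fun ε : ℝ => ε * |l i v| := by fun_prop
          simpa using hcont.tendsto 0)
      exact (ht.eventually_lt_const h).mono fun _ => le_of_lt
  obtain ⟨ε, hε, hε0⟩ := ((Filter.eventually_all.2 hε).and self_mem_nhdsWithin).exists
  have hε0 : 0 < ε := hε0
  have hbound : ∀ i, |ε * l i v| ≤ l i x + k i := fun i => by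
    rw [abs_mul, abs_of_pos hε0]; exact hε i
  have hadd : x + ε • v ∈ {x : E | ∀ i, 0 ≤ l i x + k i} := fun i => by
    have := (abs_le.1 (hbound i)).1
    simp only [map_add, map_smul, smul_eq_mul]; linarith
  have hsub : x - ε • v ∈ {x : E | ∀ i, 0 ≤ l i x + k i} := fun i => by
    have := (abs_le.1 (hbound i)).2
    simp only [map_sub, map_smul, smul_eq_mul]; linarith
  have hmid : x ∈ openSegment ℝ (x + ε • v) (x - ε • v) :=
    ⟨1 / 2, 1 / 2, by norm_num, by norm_num, by norm_num, by module⟩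
  have h := hx.2 hadd hsub hmid
  simpa [hε0.ne'] using h

/-- A compact polyhedron is the convex hull of any finite subset containing all the points whose
active constraints have trivial common kernel. -/
theorem polyhedron_eq_convexHull {E ι : Type*} [AddCommGroup E] [Module ℝ E] [TopologicalSpace E]
    [T2Space E] [IsTopologicalAddGroup E] [ContinuousSMul ℝ E] [LocallyConvexSpace ℝ E] [Finite ι]
    (l : ι → E →ₗ[ℝ] ℝ) (k : ι → ℝ) (hc : IsCompact {x : E | ∀ i, 0 ≤ l i x + k i})
    {V : Set E} (hV : V.Finite) (hVsub : ∀ x ∈ V, ∀ i, 0 ≤ l i x + k i)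
    (hmem : ∀ x, (∀ i, 0 ≤ l i x + k i) →
      (∀ v, (∀ i, l i x + k i = 0 → l i v = 0) → v = 0) → x ∈ V) :
    {x : E | ∀ i, 0 ≤ l i x + k i} = convexHull ℝ V := by
  have hconv : Convex ℝ {x : E | ∀ i, 0 ≤ l i x + k i} := by
    intro x hx y hy s t hs ht hst i
    have h : l i (s • x + t • y) + k i = s * (l i x + k i) + t * (l i y + k i) := by
      simp only [map_add, map_smul, smul_eq_mul]
      linear_combination (-(k i)) * hst
    rw [h]
    exact add_nonneg (mul_nonneg hs (hx i)) (mul_nonneg ht (hy i))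
  refine Set.Subset.antisymm ?_ (convexHull_min hVsub hconv)
  rw [← closure_convexHull_extremePoints hc hconv]
  refine closure_minimal (convexHull_mono fun x hx => ?_) (hV.isClosed_convexHull ℝ)
  exact hmem x hx.1 fun v => eq_zero_of_mem_extremePoints_polyhedron l k hx

/-- The points `(a, b, c)` that are, in rescaled coordinates `a = p x`, `b = q y`, `c = r z`,
among the ten vertices. -/
def IsRescaledVertex (n s p q r a b c : ℝ) : Prop :=
  (a = 0 ∧ b = 0 ∧ c = 0) ∨
  (n * a = (n + 1) * p - s ∧ b = 0 ∧ c = 0) ∨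
  (a = 0 ∧ n * b = (n + 1) * q - s ∧ c = 0) ∨
  (a = 0 ∧ b = 0 ∧ n * c = (n + 1) * r - s) ∨
  (s ≤ q + r ∧ a = 0 ∧ (b = q ∧ c = s - q ∨ b = s - r ∧ c = r)) ∨
  (q + r < s ∧ (a = 0 ∧ (n - 1) * b = r + n * q - s ∧ (n - 1) * c = q + n * r - s ∨
    a = s - (q + r) ∧ b = q ∧ c = r)) ∨
  (s ≤ p + r ∧ b = 0 ∧ (a = p ∧ c = s - p ∨ a = s - r ∧ c = r)) ∨
  (p + r < s ∧ (b = 0 ∧ (n - 1) * a = r + n * p - s ∧ (n - 1) * c = p + n * r - s ∨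
    b = s - (p + r) ∧ a = p ∧ c = r)) ∨
  (s ≤ p + q ∧ c = 0 ∧ (a = p ∧ b = s - p ∨ a = s - q ∧ b = q)) ∨
  (p + q < s ∧ (c = 0 ∧ (n - 1) * a = q + n * p - s ∧ (n - 1) * b = p + n * q - s ∨
    c = s - (p + q) ∧ a = p ∧ b = q))

theorem IsRescaledVertex.rotate {n s p q r a b c : ℝ} (h : IsRescaledVertex n s p q r a b c) :
    IsRescaledVertex n s q r p b c a := by
  unfold IsRescaledVertex at *
  rw [add_comm q p, add_comm r p]
  rcases h with h | h | h | h | h | h | h | h | h | h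
  · exact Or.inl (by tauto)
  · exact Or.inr (Or.inr (Or.inr (Or.inl (by tauto))))
  · exact Or.inr (Or.inl (by tauto))
  · exact Or.inr (Or.inr (Or.inl (by tauto)))
  · exact Or.inr (Or.inr (Or.inr (Or.inr (Or.inr (Or.inr (Or.inr (Or.inr (Or.inl (by tauto)))))))))
  · exact Or.inr (Or.inr (Or.inr (Or.inr (Or.inr (Or.inr (Or.inr (Or.inr (Or.inr (by tauto)))))))))
  · exact Or.inr (Or.inr (Or.inr (Or.inr (Or.inl (by tauto)))))
  · exact Or.inr (Or.inr (Or.inr (Or.inr (Or.inr (Or.inl (by tauto))))))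
  · exact Or.inr (Or.inr (Or.inr (Or.inr (Or.inr (Or.inr (Or.inl (by tauto)))))))
  · exact Or.inr (Or.inr (Or.inr (Or.inr (Or.inr (Or.inr (Or.inr (Or.inl (by tauto))))))))

theorem IsRescaledVertex.swap {n s p q r a b c : ℝ} (h : IsRescaledVertex n s p q r a b c) :
    IsRescaledVertex n s q p r b a c := by
  unfold IsRescaledVertex at *
  rw [add_comm q p]
  rcases h with h | h | h | h | h | h | h | h | h | h
  · exact Or.inl (by tauto)
  · exact Or.inr (Or.inr (Or.inl (by tauto)))
  · exact Or.inr (Or.inl (by tauto))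
  · exact Or.inr (Or.inr (Or.inr (Or.inl (by tauto))))
  · exact Or.inr (Or.inr (Or.inr (Or.inr (Or.inr (Or.inr (Or.inl (by tauto)))))))
  · exact Or.inr (Or.inr (Or.inr (Or.inr (Or.inr (Or.inr (Or.inr (Or.inl (by tauto))))))))
  · exact Or.inr (Or.inr (Or.inr (Or.inr (Or.inl (by tauto)))))
  · exact Or.inr (Or.inr (Or.inr (Or.inr (Or.inr (Or.inl (by tauto))))))
  · exact Or.inr (Or.inr (Or.inr (Or.inr (Or.inr (Or.inr (Or.inr (Or.inr (Or.inl (by tauto)))))))))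
  · exact Or.inr (Or.inr (Or.inr (Or.inr (Or.inr (Or.inr (Or.inr (Or.inr (Or.inr (by tauto)))))))))

/-- The rescaled inequalities, together with the triviality of the common kernel of the active
ones. -/
structure IsRescaledExtreme (n s p q r a b c : ℝ) : Prop where
  nonneg₁ : 0 ≤ a
  nonneg₂ : 0 ≤ b
  nonneg₃ : 0 ≤ c
  sum_le : a + b + c ≤ s
  le₁ : n * a ≤ (n + 1) * p - s + b + c
  le₂ : n * b ≤ (n + 1) * q - s + a + c
  le₃ : n * c ≤ (n + 1) * r - s + a + b
  kernel : ∀ u v w : ℝ, (a = 0 → u = 0) → (b = 0 → v = 0) → (c = 0 → w = 0) →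
    (a + b + c = s → u + v + w = 0) →
    (n * a = (n + 1) * p - s + b + c → n * u = v + w) →
    (n * b = (n + 1) * q - s + a + c → n * v = u + w) →
    (n * c = (n + 1) * r - s + a + b → n * w = u + v) → u = 0 ∧ v = 0 ∧ w = 0

namespace IsRescaledExtreme

variable {n s p q r a b c : ℝ}

theorem rotate (h : IsRescaledExtreme n s p q r a b c) : IsRescaledExtreme n s q r p b c a where
  nonneg₁ := h.nonneg₂
  nonneg₂ := h.nonneg₃
  nonneg₃ := h.nonneg₁
  sum_le := by linarith [h.sum_le]
  le₁ := by linarith [h.le₂]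
  le₂ := by linarith [h.le₃]
  le₃ := by linarith [h.le₁]
  kernel u v w h₁ h₂ h₃ h₄ h₅ h₆ h₇ := by
    have := h.kernel w u v h₃ h₁ h₂ (fun e => by linarith [h₄ (by linarith)])
      (fun e => by linarith [h₇ (by linarith)]) (fun e => by linarith [h₅ (by linarith)])
      (fun e => by linarith [h₆ (by linarith)])
    tauto

theorem swap (h : IsRescaledExtreme n s p q r a b c) : IsRescaledExtreme n s q p r b a c where
  nonneg₁ := h.nonneg₂
  nonneg₂ := h.nonneg₁
  nonneg₃ := h.nonneg₃
  sum_le := by linarith [h.sum_le]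
  le₁ := by linarith [h.le₂]
  le₂ := by linarith [h.le₁]
  le₃ := by linarith [h.le₃]
  kernel u v w h₁ h₂ h₃ h₄ h₅ h₆ h₇ := by
    have := h.kernel v u w h₂ h₁ h₃ (fun e => by linarith [h₄ (by linarith)])
      (fun e => by linarith [h₆ (by linarith)]) (fun e => by linarith [h₅ (by linarith)])
      (fun e => by linarith [h₇ (by linarith)])
    tauto

theorem isRescaledVertex_of_eq_zero_of_eq_zero (h : IsRescaledExtreme n s p q r a b c)
    (hn : 2 ≤ n) (hp : s ≤ (n + 1) * p) (hq : s ≤ (n + 1) * q) (hr : r ≤ s)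
    (ha : a = 0) (hb : b = 0) : IsRescaledVertex n s p q r a b c := by
  obtain ⟨-, -, h₃, hs, -, -, hl₃, hk⟩ := h
  unfold IsRescaledVertex
  subst ha hb
  by_cases hc : c = 0
  · exact Or.inl ⟨rfl, rfl, hc⟩
  by_cases hc' : n * c = (n + 1) * r - s + 0 + 0
  · exact Or.inr (Or.inr (Or.inr (Or.inl ⟨rfl, rfl, by linarith⟩)))
  have hc₀ : 0 < c := lt_of_le_of_ne h₃ (Ne.symm hc)
  have := hk 0 0 1 (by simp) (by simp) (fun e => absurd e hc)
    (fun e => absurd (by nlinarith) hc') (fun e => by linarith) (fun e => by linarith)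
    (fun e => absurd e hc')
  norm_num at this

theorem isRescaledVertex_of_eq_zero_of_active (h : IsRescaledExtreme n s p q r a b c)
    (hn : 2 ≤ n) (hp : s ≤ (n + 1) * p) (hq : s ≤ (n + 1) * q)
    (ha : a = 0) (hb : n * b = (n + 1) * q - s + a + c) : IsRescaledVertex n s p q r a b c := by
  obtain ⟨-, h₂, h₃, hs, -, -, hl₃, hk⟩ := h
  unfold IsRescaledVertex
  subst ha
  have hn₁ : n + 1 ≠ 0 := by positivity
  rcases hs.eq_or_lt with ht | ht
  · have hbq : b = q := mul_left_cancel₀ hn₁ (by linarith)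
    have hcr : c ≤ r := le_of_mul_le_mul_left (a := n + 1) (by linarith) (by positivity)
    exact Or.inr (Or.inr (Or.inr (Or.inr (Or.inl
      ⟨by linarith, rfl, Or.inl ⟨hbq, by linarith⟩⟩))))
  by_cases hc : c = 0
  · exact Or.inr (Or.inr (Or.inl ⟨rfl, by linarith, hc⟩))
  by_cases hc' : n * c = (n + 1) * r - s + 0 + b
  · refine Or.inr (Or.inr (Or.inr (Or.inr (Or.inr (Or.inl
      ⟨?_, Or.inl ⟨rfl, mul_left_cancel₀ hn₁ ?_, mul_left_cancel₀ hn₁ ?_⟩⟩)))))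
    · refine lt_of_mul_lt_mul_left (a := n + 1) ?_ (by positivity)
      nlinarith
    · linear_combination n * hb + hc'
    · linear_combination n * hc' + hb
  have hc₀ : 0 < c := lt_of_le_of_ne h₃ (Ne.symm hc)
  have := hk 0 1 n (by simp) (fun e => by subst e; linarith) (fun e => absurd e hc)
    (fun e => by linarith) (fun e => by linarith) (fun e => by linarith)
    (fun e => absurd e hc')
  norm_num at this

theorem isRescaledVertex_of_active_of_active (h : IsRescaledExtreme n s p q r a b c)
    (hn : 2 ≤ n) (hp : s ≤ (n + 1) * p) (hq : s ≤ (n + 1) * q) (hpqr : s ≤ p + q + r)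
    (ha : n * a = (n + 1) * p - s + b + c) (hb : n * b = (n + 1) * q - s + a + c) :
    IsRescaledVertex n s p q r a b c := by
  by_cases ha₀ : a = 0
  · exact h.isRescaledVertex_of_eq_zero_of_active hn hp hq ha₀ hb
  by_cases hb₀ : b = 0
  · exact (h.swap.isRescaledVertex_of_eq_zero_of_active hn hq hp hb₀ ha).swap
  obtain ⟨-, -, h₃, hs, -, -, -, hk⟩ := h
  unfold IsRescaledVertex
  have hn₁ : n + 1 ≠ 0 := by positivity
  rcases hs.eq_or_lt with ht | ht
  · have hap : a = p := mul_left_cancel₀ hn₁ (by linarith)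
    have hbq : b = q := mul_left_cancel₀ hn₁ (by linarith)
    rcases lt_or_ge (p + q) s with hlt | hge
    · exact Or.inr (Or.inr (Or.inr (Or.inr (Or.inr (Or.inr (Or.inr (Or.inr (Or.inr
        ⟨hlt, Or.inr ⟨by linarith, hap, hbq⟩⟩))))))))
    · exact Or.inr (Or.inr (Or.inr (Or.inr (Or.inr (Or.inr (Or.inr (Or.inr (Or.inl
        ⟨hge, by linarith, Or.inl ⟨hap, by linarith⟩⟩))))))))
  by_cases hc : c = 0
  · subst hc
    refine Or.inr (Or.inr (Or.inr (Or.inr (Or.inr (Or.inr (Or.inr (Or.inr (Or.inr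
      ⟨?_, Or.inl ⟨rfl, mul_left_cancel₀ hn₁ ?_, mul_left_cancel₀ hn₁ ?_⟩⟩))))))))
    · refine lt_of_mul_lt_mul_left (a := n + 1) ?_ (by positivity)
      nlinarith
    · linear_combination n * ha + hb
    · linear_combination n * hb + ha
  exfalso
  by_cases hc' : n * c = (n + 1) * r - s + a + b
  · have hn₂ : n = 2 := by
      refine le_antisymm ?_ hn
      by_contra! hlt
      nlinarith [mul_pos (sub_pos.2 hlt) (sub_pos.2 ht)]
    have := hk 1 1 1 (by simp [ha₀]) (by simp [hb₀]) (by simp [hc]) (fun e => by linarith)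
      (fun _ => by linarith) (fun _ => by linarith) (fun _ => by linarith)
    norm_num at this
  · have := hk 1 1 (n - 1) (by simp [ha₀]) (by simp [hb₀]) (by simp [hc]) (fun e => by linarith)
      (fun _ => by linarith) (fun _ => by linarith) (fun e => absurd e hc')
    norm_num at this

theorem isRescaledVertex_of_two_active (h : IsRescaledExtreme n s p q r a b c)
    (hn : 2 ≤ n) (hp : s ≤ (n + 1) * p) (hq : s ≤ (n + 1) * q) (hr : r ≤ s)
    (hpqr : s ≤ p + q + r) (ha : a = 0 ∨ n * a = (n + 1) * p - s + b + c)
    (hb : b = 0 ∨ n * b = (n + 1) * q - s + a + c) : IsRescaledVertex n s p q r a b c := by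
  rcases ha with ha | ha <;> rcases hb with hb | hb
  · exact h.isRescaledVertex_of_eq_zero_of_eq_zero hn hp hq hr ha hb
  · exact h.isRescaledVertex_of_eq_zero_of_active hn hp hq ha hb
  · exact (h.swap.isRescaledVertex_of_eq_zero_of_active hn hq hp hb ha).swap
  · exact h.isRescaledVertex_of_active_of_active hn hp hq hpqr ha hb

theorem active_or_active (h : IsRescaledExtreme n s p q r a b c) :
    (a = 0 ∨ n * a = (n + 1) * p - s + b + c) ∨ (b = 0 ∨ n * b = (n + 1) * q - s + a + c) := by
  by_contra! hcon
  obtain ⟨⟨ha, ha'⟩, hb, hb'⟩ := hcon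
  have := h.kernel 1 (-1) 0 (by simp [ha]) (by simp [hb]) (by simp) (by simp) (by simp [ha'])
    (by simp [hb']) (by simp)
  norm_num at this

theorem isRescaledVertex (h : IsRescaledExtreme n s p q r a b c) (hn : 2 ≤ n)
    (hp : s ≤ (n + 1) * p) (hq : s ≤ (n + 1) * q) (hr : s ≤ (n + 1) * r)
    (hp' : p ≤ s) (hq' : q ≤ s) (hr' : r ≤ s) (hpqr : s ≤ p + q + r) :
    IsRescaledVertex n s p q r a b c := by
  have hab := h.active_or_active
  have hbc := h.rotate.active_or_active
  have hca := h.rotate.rotate.active_or_active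
  rw [add_right_comm _ c a, add_right_comm _ b a] at hbc
  rw [add_right_comm _ c b] at hca
  by_cases ha : a = 0 ∨ n * a = (n + 1) * p - s + b + c
  · by_cases hb : b = 0 ∨ n * b = (n + 1) * q - s + a + c
    · exact h.isRescaledVertex_of_two_active hn hp hq hr' hpqr ha hb
    · have hc : c = 0 ∨ n * c = (n + 1) * r - s + a + b := by tauto
      rw [add_right_comm] at ha
      exact (h.rotate.rotate.isRescaledVertex_of_two_active hn hr hp hq' (by linarith)
        hc ha).rotate
  · have hb := hab.resolve_left ha
    have hc : c = 0 ∨ n * c = (n + 1) * r - s + a + b := by tauto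
    rw [add_right_comm] at hb hc
    exact (h.rotate.isRescaledVertex_of_two_active hn hq hr hp' (by linarith) hb hc).rotate.rotate

end IsRescaledExtreme

/-- The polytope cut out by the cleared-denominator inequalities. -/
def clearedPolytope (n s p q r : ℝ) : Set (ℝ × ℝ × ℝ) :=
  {x | 0 ≤ x.1 ∧ 0 ≤ x.2.1 ∧ 0 ≤ x.2.2 ∧ p * x.1 + q * x.2.1 + r * x.2.2 ≤ s ∧
    n * (p * x.1) ≤ (n + 1) * p - s + q * x.2.1 + r * x.2.2 ∧
    n * (q * x.2.1) ≤ (n + 1) * q - s + p * x.1 + r * x.2.2 ∧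
    n * (r * x.2.2) ≤ (n + 1) * r - s + p * x.1 + q * x.2.1}

theorem le_one_of_mem_clearedPolytope {n s p q r : ℝ} (hn : 2 ≤ n) (hp : 0 < p) (hq : 0 < q)
    (hr : 0 < r) {x : ℝ × ℝ × ℝ} (hx : x ∈ clearedPolytope n s p q r) :
    x.1 ≤ 1 ∧ x.2.1 ≤ 1 ∧ x.2.2 ≤ 1 := by
  obtain ⟨-, -, -, hs, h₁, h₂, h₃⟩ := hx
  have hn₁ : 0 < n + 1 := by linarith
  refine ⟨le_of_mul_le_mul_left ?_ (mul_pos hn₁ hp), le_of_mul_le_mul_left ?_ (mul_pos hn₁ hq),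
    le_of_mul_le_mul_left ?_ (mul_pos hn₁ hr)⟩ <;> linarith

theorem isClosed_clearedPolytope (n s p q r : ℝ) : IsClosed (clearedPolytope n s p q r) := by
  unfold clearedPolytope
  simp only [Set.ofPred_and]
  refine IsClosed.inter ?_ (IsClosed.inter ?_ (IsClosed.inter ?_ (IsClosed.inter ?_
    (IsClosed.inter ?_ (IsClosed.inter ?_ ?_))))) <;>
  exact isClosed_le (by fun_prop) (by fun_prop)

theorem isCompact_clearedPolytope {n s p q r : ℝ} (hn : 2 ≤ n) (hp : 0 < p) (hq : 0 < q)
    (hr : 0 < r) : IsCompact (clearedPolytope n s p q r) := by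
  refine (isCompact_Icc (a := ((0 : ℝ), (0 : ℝ), (0 : ℝ))) (b := (1, 1, 1))).of_isClosed_subset
    (isClosed_clearedPolytope n s p q r) fun x hx => ?_
  have h := le_one_of_mem_clearedPolytope hn hp hq hr hx
  exact ⟨⟨hx.1, hx.2.1, hx.2.2.1⟩, h⟩

/-- The linear form `(x, y, z) ↦ α x + β y + γ z`. -/
def linearForm (α β γ : ℝ) : ℝ × ℝ × ℝ →ₗ[ℝ] ℝ where
  toFun x := α * x.1 + β * x.2.1 + γ * x.2.2
  map_add' x y := by simp only [Prod.fst_add, Prod.snd_add]; ring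
  map_smul' t x := by
    simp only [Prod.smul_fst, Prod.smul_snd, smul_eq_mul, RingHom.id_apply]; ring

theorem linearForm_apply (α β γ : ℝ) (x : ℝ × ℝ × ℝ) :
    linearForm α β γ x = α * x.1 + β * x.2.1 + γ * x.2.2 := rfl

theorem clearedPolytope_eq_convexHull {n s p q r : ℝ} (hn : 2 ≤ n)
    (hp₀ : 0 < p) (hq₀ : 0 < q) (hr₀ : 0 < r)
    (hp : s ≤ (n + 1) * p) (hq : s ≤ (n + 1) * q) (hr : s ≤ (n + 1) * r)
    (hp' : p ≤ s) (hq' : q ≤ s) (hr' : r ≤ s) (hpqr : s ≤ p + q + r)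
    {V : Set (ℝ × ℝ × ℝ)} (hV : V.Finite) (hVsub : V ⊆ clearedPolytope n s p q r)
    (hmem : ∀ x : ℝ × ℝ × ℝ, IsRescaledVertex n s p q r (p * x.1) (q * x.2.1) (r * x.2.2) →
      x ∈ V) :
    clearedPolytope n s p q r = convexHull ℝ V := by
  let l : Fin 7 → ℝ × ℝ × ℝ →ₗ[ℝ] ℝ := ![linearForm 1 0 0, linearForm 0 1 0, linearForm 0 0 1,
    linearForm (-p) (-q) (-r), linearForm (-(n * p)) q r, linearForm p (-(n * q)) r,
    linearForm p q (-(n * r))]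
  let k : Fin 7 → ℝ := ![0, 0, 0, s, (n + 1) * p - s, (n + 1) * q - s, (n + 1) * r - s]
  have heq : clearedPolytope n s p q r = {x | ∀ i, 0 ≤ l i x + k i} := by
    ext x
    simp only [clearedPolytope, Set.mem_ofPred_eq, Fin.forall_fin_succ, l, k, linearForm_apply,
      Matrix.cons_val_zero, Matrix.cons_val_succ, IsEmpty.forall_iff, and_true]
    refine and_congr ?_ (and_congr ?_ (and_congr ?_ (and_congr ?_ (and_congr ?_ (and_congr ?_
      ?_))))) <;> constructor <;> intro h <;> linarith
  have hmem' : ∀ x, (∀ i, 0 ≤ l i x + k i) →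
      (∀ v, (∀ i, l i x + k i = 0 → l i v = 0) → v = 0) → x ∈ V := by
    intro x hx hk
    have hx' : x ∈ clearedPolytope n s p q r := heq ▸ hx
    obtain ⟨h₁, h₂, h₃, h₄, h₅, h₆, h₇⟩ := hx'
    refine hmem x (IsRescaledExtreme.isRescaledVertex ⟨by positivity, by positivity, by positivity,
      h₄, h₅, h₆, h₇, fun u v w e₁ e₂ e₃ e₄ e₅ e₆ e₇ => ?_⟩ hn hp hq hr hp' hq' hr' hpqr)
    have hu : p * (u / p) = u := by field_simp
    have hv : q * (v / q) = v := by field_simp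
    have hw : r * (w / r) = w := by field_simp
    have h := hk (u / p, v / q, w / r) (by
      simp only [Fin.forall_fin_succ, l, k, linearForm_apply,
        Matrix.cons_val_zero, Matrix.cons_val_succ, IsEmpty.forall_iff, and_true]
      refine ⟨fun e => ?_, fun e => ?_, fun e => ?_, fun e => ?_, fun e => ?_, fun e => ?_,
        fun e => ?_⟩
      · have hx₁ : x.1 = 0 := by linarith
        simp [e₁ (by simp [hx₁])]
      · have hx₂ : x.2.1 = 0 := by linarith
        simp [e₂ (by simp [hx₂])]
      · have hx₃ : x.2.2 = 0 := by linarith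
        simp [e₃ (by simp [hx₃])]
      · linarith [e₄ (by linarith)]
      · linear_combination hv + hw - n * hu - e₅ (by linarith)
      · linear_combination hu + hw - n * hv - e₆ (by linarith)
      · linear_combination hu + hv - n * hw - e₇ (by linarith))
    simpa [hp₀.ne', hq₀.ne', hr₀.ne'] using h
  rw [heq]
  exact polyhedron_eq_convexHull l k (heq ▸ isCompact_clearedPolytope hn hp₀ hq₀ hr₀) hV
    (fun x hx => (heq ▸ hVsub hx : x ∈ {x | ∀ i, 0 ≤ l i x + k i})) hmem'

/-- Membership in the polytope, parametrised by the slack `(n + 1) u` of the sum constraint. -/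
theorem mem_clearedPolytope_of_slack {n s p q r a b c u : ℝ} (hn : 2 ≤ n) (hp₀ : 0 < p)
    (hq₀ : 0 < q) (hr₀ : 0 < r) (hu : 0 ≤ u) (ha : 0 ≤ a) (hb : 0 ≤ b) (hc : 0 ≤ c)
    (hsum : a + b + c = s - (n + 1) * u) (ha' : a ≤ p - u) (hb' : b ≤ q - u) (hc' : c ≤ r - u) :
    (a / p, b / q, c / r) ∈ clearedPolytope n s p q r := by
  have hn₁ : 0 ≤ n + 1 := by linarith
  have hap : p * (a / p) = a := by field_simp
  have hbq : q * (b / q) = b := by field_simp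
  have hcr : r * (c / r) = c := by field_simp
  refine ⟨by positivity, by positivity, by positivity, ?_, ?_, ?_, ?_⟩ <;>
    simp only [hap, hbq, hcr]
  · linarith [mul_nonneg hn₁ hu]
  · linarith [mul_le_mul_of_nonneg_left ha' hn₁]
  · linarith [mul_le_mul_of_nonneg_left hb' hn₁]
  · linarith [mul_le_mul_of_nonneg_left hc' hn₁]

theorem mem_clearedPolytope_rotate {n s p q r x y z : ℝ}
    (h : (y, z, x) ∈ clearedPolytope n s q r p) : (x, y, z) ∈ clearedPolytope n s p q r := by
  obtain ⟨h₁, h₂, h₃, h₄, h₅, h₆, h₇⟩ := h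
  exact ⟨h₃, h₁, h₂, by linarith, by linarith, by linarith, by linarith⟩

section Vertices

variable {n s p q r : ℝ}

theorem axis_mem_clearedPolytope (hn : 2 ≤ n) (hp₀ : 0 < p) (hq₀ : 0 < q) (hr₀ : 0 < r)
    (hp : s ≤ (n + 1) * p) (hq : s ≤ (n + 1) * q) (hr : s ≤ (n + 1) * r) (hp' : p ≤ s) :
    (((n + 1) * p - s) / (n * p), 0, 0) ∈ clearedPolytope n s p q r := by
  have hn₀ : 0 < n := by linarith
  have hu : (s - p) / n ≤ s / (n + 1) := by
    rw [div_le_div_iff₀ hn₀ (by linarith)]; linarith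
  have hle : ∀ t, s ≤ (n + 1) * t → (s - p) / n ≤ t := fun t ht =>
    hu.trans ((div_le_iff₀' (by linarith)).2 ht)
  have := mem_clearedPolytope_of_slack (a := p - (s - p) / n) (b := 0) (c := 0) (s := s)
    (u := (s - p) / n) hn hp₀ hq₀ hr₀ (div_nonneg (by linarith) hn₀.le)
    (by linarith [hle p hp]) le_rfl le_rfl (by field_simp; ring) le_rfl
    (by linarith [hle q hq]) (by linarith [hle r hr])
  convert this using 2
  · field_simp; ring
  · simp

theorem edge_left_mem_clearedPolytope (hn : 2 ≤ n) (hp₀ : 0 < p) (hq₀ : 0 < q) (hr₀ : 0 < r)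
    (hp' : p ≤ s) (hpq : s ≤ p + q) : (1, (s - p) / q, 0) ∈ clearedPolytope n s p q r := by
  have := mem_clearedPolytope_of_slack (a := p) (b := s - p) (c := 0) (s := s) (u := 0)
    hn hp₀ hq₀ hr₀ le_rfl hp₀.le (by linarith) le_rfl (by ring) (by linarith) (by linarith)
    (by linarith)
  simpa [hp₀.ne'] using this

theorem edge_right_mem_clearedPolytope (hn : 2 ≤ n) (hp₀ : 0 < p) (hq₀ : 0 < q) (hr₀ : 0 < r)
    (hq' : q ≤ s) (hpq : s ≤ p + q) : ((s - q) / p, 1, 0) ∈ clearedPolytope n s p q r := by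
  have := mem_clearedPolytope_of_slack (a := s - q) (b := q) (c := 0) (s := s) (u := 0)
    hn hp₀ hq₀ hr₀ le_rfl (by linarith) hq₀.le le_rfl (by ring) (by linarith) (by linarith)
    (by linarith)
  simpa [hq₀.ne'] using this

theorem face_mem_clearedPolytope (hn : 2 ≤ n) (hp₀ : 0 < p) (hq₀ : 0 < q) (hr₀ : 0 < r)
    (hp : s ≤ (n + 1) * p) (hq : s ≤ (n + 1) * q) (hr : s ≤ (n + 1) * r) (hpq : p + q ≤ s) :
    ((q + n * p - s) / ((n - 1) * p), (p + n * q - s) / ((n - 1) * q), 0) ∈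
      clearedPolytope n s p q r := by
  have hn₁ : 0 < n - 1 := by linarith
  have hu : (s - (p + q)) / (n - 1) ≤ s / (n + 1) := by
    rw [div_le_div_iff₀ hn₁ (by linarith)]; linarith
  have hle : ∀ t, s ≤ (n + 1) * t → (s - (p + q)) / (n - 1) ≤ t := fun t ht =>
    hu.trans ((div_le_iff₀' (by linarith)).2 ht)
  have := mem_clearedPolytope_of_slack (a := p - (s - (p + q)) / (n - 1))
    (b := q - (s - (p + q)) / (n - 1)) (c := 0) (s := s) (u := (s - (p + q)) / (n - 1))
    hn hp₀ hq₀ hr₀ (div_nonneg (by linarith) hn₁.le)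
    (by linarith [hle p hp]) (by linarith [hle q hq]) le_rfl (by field_simp; ring) le_rfl le_rfl
    (by linarith [hle r hr])
  convert this using 2
  · field_simp; ring
  · refine Prod.ext ?_ (by simp)
    simp only
    field_simp; ring

theorem top_mem_clearedPolytope (hn : 2 ≤ n) (hp₀ : 0 < p) (hq₀ : 0 < q) (hr₀ : 0 < r)
    (hpq : p + q ≤ s) (hpqr : s ≤ p + q + r) :
    (1, 1, (s - (p + q)) / r) ∈ clearedPolytope n s p q r := by
  have := mem_clearedPolytope_of_slack (a := p) (b := q) (c := s - (p + q)) (s := s) (u := 0)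
    hn hp₀ hq₀ hr₀ le_rfl hp₀.le hq₀.le (by linarith) (by ring) (by linarith) (by linarith)
    (by linarith)
  simpa [hp₀.ne', hq₀.ne'] using this

end Vertices

theorem clearedPolytope_eq_convexHull_ten_points {n s p q r : ℝ} (hn : 2 ≤ n)
    (hp₀ : 0 < p) (hq₀ : 0 < q) (hr₀ : 0 < r)
    (hp : s ≤ (n + 1) * p) (hq : s ≤ (n + 1) * q) (hr : s ≤ (n + 1) * r)
    (hp' : p ≤ s) (hq' : q ≤ s) (hr' : r ≤ s) (hpqr : s ≤ p + q + r)
    {A₁ B₁ A₂ B₂ A₃ B₃ : ℝ × ℝ × ℝ}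
    (h₁ : s ≤ q + r → A₁ = (0, 1, (s - q) / r) ∧ B₁ = (0, (s - r) / q, 1))
    (h₁' : q + r < s → A₁ = (0, (r + n * q - s) / ((n - 1) * q), (q + n * r - s) / ((n - 1) * r)) ∧
      B₁ = ((s - (q + r)) / p, 1, 1))
    (h₂ : s ≤ p + r → A₂ = (1, 0, (s - p) / r) ∧ B₂ = ((s - r) / p, 0, 1))
    (h₂' : p + r < s → A₂ = ((r + n * p - s) / ((n - 1) * p), 0, (p + n * r - s) / ((n - 1) * r)) ∧
      B₂ = (1, (s - (p + r)) / q, 1))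
    (h₃ : s ≤ p + q → A₃ = (1, (s - p) / q, 0) ∧ B₃ = ((s - q) / p, 1, 0))
    (h₃' : p + q < s → A₃ = ((q + n * p - s) / ((n - 1) * p), (p + n * q - s) / ((n - 1) * q), 0) ∧
      B₃ = (1, 1, (s - (p + q)) / r)) :
    clearedPolytope n s p q r = convexHull ℝ {((0 : ℝ), (0 : ℝ), (0 : ℝ)),
      (((n + 1) * p - s) / (n * p), 0, 0), (0, ((n + 1) * q - s) / (n * q), 0),
      (0, 0, ((n + 1) * r - s) / (n * r)), A₁, B₁, A₂, B₂, A₃, B₃} := by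
  have hn₀ : n ≠ 0 := by positivity
  have hn₁ : n - 1 ≠ 0 := by linarith
  refine clearedPolytope_eq_convexHull hn hp₀ hq₀ hr₀ hp hq hr hp' hq' hr' hpqr
    (Set.toFinite _) ?_ ?_
  · have hone : A₁ ∈ clearedPolytope n s p q r ∧ B₁ ∈ clearedPolytope n s p q r := by
      rcases le_or_gt s (q + r) with h | h
      · obtain ⟨rfl, rfl⟩ := h₁ h
        exact ⟨mem_clearedPolytope_rotate (edge_left_mem_clearedPolytope hn hq₀ hr₀ hp₀ hq' h),
          mem_clearedPolytope_rotate (edge_right_mem_clearedPolytope hn hq₀ hr₀ hp₀ hr' h)⟩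
      · obtain ⟨rfl, rfl⟩ := h₁' h
        exact ⟨mem_clearedPolytope_rotate
            (face_mem_clearedPolytope hn hq₀ hr₀ hp₀ hq hr hp h.le),
          mem_clearedPolytope_rotate
            (top_mem_clearedPolytope hn hq₀ hr₀ hp₀ h.le (by linarith))⟩
    have htwo : A₂ ∈ clearedPolytope n s p q r ∧ B₂ ∈ clearedPolytope n s p q r := by
      rcases le_or_gt s (p + r) with h | h
      · obtain ⟨rfl, rfl⟩ := h₂ h
        rw [add_comm] at h
        exact ⟨mem_clearedPolytope_rotate (mem_clearedPolytope_rotate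
            (edge_right_mem_clearedPolytope hn hr₀ hp₀ hq₀ hp' h)),
          mem_clearedPolytope_rotate (mem_clearedPolytope_rotate
            (edge_left_mem_clearedPolytope hn hr₀ hp₀ hq₀ hr' h))⟩
      · obtain ⟨rfl, rfl⟩ := h₂' h
        rw [add_comm p r] at h ⊢
        exact ⟨mem_clearedPolytope_rotate (mem_clearedPolytope_rotate
            (face_mem_clearedPolytope hn hr₀ hp₀ hq₀ hr hp hq h.le)),
          mem_clearedPolytope_rotate (mem_clearedPolytope_rotate
            (top_mem_clearedPolytope hn hr₀ hp₀ hq₀ h.le (by linarith)))⟩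
    have hthree : A₃ ∈ clearedPolytope n s p q r ∧ B₃ ∈ clearedPolytope n s p q r := by
      rcases le_or_gt s (p + q) with h | h
      · obtain ⟨rfl, rfl⟩ := h₃ h
        exact ⟨edge_left_mem_clearedPolytope hn hp₀ hq₀ hr₀ hp' h,
          edge_right_mem_clearedPolytope hn hp₀ hq₀ hr₀ hq' h⟩
      · obtain ⟨rfl, rfl⟩ := h₃' h
        exact ⟨face_mem_clearedPolytope hn hp₀ hq₀ hr₀ hp hq hr h.le,
          top_mem_clearedPolytope hn hp₀ hq₀ hr₀ h.le hpqr⟩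
    have hzero : ((0 : ℝ), (0 : ℝ), (0 : ℝ)) ∈ clearedPolytope n s p q r :=
      ⟨le_rfl, le_rfl, le_rfl, by linarith, by linarith, by linarith, by linarith⟩
    simp only [Set.insert_subset_iff, Set.singleton_subset_iff]
    exact ⟨hzero, axis_mem_clearedPolytope hn hp₀ hq₀ hr₀ hp hq hr hp',
      mem_clearedPolytope_rotate (axis_mem_clearedPolytope hn hq₀ hr₀ hp₀ hq hr hp hq'),
      mem_clearedPolytope_rotate (mem_clearedPolytope_rotate
        (axis_mem_clearedPolytope hn hr₀ hp₀ hq₀ hr hp hq hr')),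
      hone.1, hone.2, htwo.1, htwo.2, hthree.1, hthree.2⟩
  · rintro ⟨x, y, z⟩ h
    have hext : ∀ {x' y' z' : ℝ}, p * x = p * x' → q * y = q * y' → r * z = r * z' →
        (x, y, z) = (x', y', z') := fun hx hy hz => by
      rw [mul_left_cancel₀ hp₀.ne' hx, mul_left_cancel₀ hq₀.ne' hy, mul_left_cancel₀ hr₀.ne' hz]
    have hdiv : ∀ {t a b : ℝ}, t ≠ 0 → a = b → a = t * (b / t) := fun ht hab => by
      rw [hab]; field_simp
    have hdiv' : ∀ {m t a b : ℝ}, m ≠ 0 → t ≠ 0 → m * a = b → a = t * (b / (m * t)) :=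
      fun hm ht hab => by rw [← hab]; field_simp
    simp only [Set.mem_insert_iff, Set.mem_singleton_iff]
    rcases h with ⟨hx, hy, hz⟩ | ⟨hx, hy, hz⟩ | ⟨hx, hy, hz⟩ | ⟨hx, hy, hz⟩ |
      ⟨h, hx, ⟨hy, hz⟩ | ⟨hy, hz⟩⟩ | ⟨h, ⟨hx, hy, hz⟩ | ⟨hx, hy, hz⟩⟩ |
      ⟨h, hy, ⟨hx, hz⟩ | ⟨hx, hz⟩⟩ | ⟨h, ⟨hy, hx, hz⟩ | ⟨hy, hx, hz⟩⟩ |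
      ⟨h, hz, ⟨hx, hy⟩ | ⟨hx, hy⟩⟩ | ⟨h, ⟨hz, hx, hy⟩ | ⟨hz, hx, hy⟩⟩
    · left
      exact hext (by linarith) (by linarith) (by linarith)
    · right; left
      exact hext (hdiv' hn₀ hp₀.ne' hx) (by linarith) (by linarith)
    · right; right; left
      exact hext (by linarith) (hdiv' hn₀ hq₀.ne' hy) (by linarith)
    · right; right; right; left
      exact hext (by linarith) (by linarith) (hdiv' hn₀ hr₀.ne' hz)
    · right; right; right; right; left
      exact (hext (by linarith) (by linarith) (hdiv hr₀.ne' hz)).trans (h₁ h).1.symm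
    · right; right; right; right; right; left
      exact (hext (by linarith) (hdiv hq₀.ne' hy) (by linarith)).trans (h₁ h).2.symm
    · right; right; right; right; left
      exact (hext (by linarith) (hdiv' hn₁ hq₀.ne' hy) (hdiv' hn₁ hr₀.ne' hz)).trans
        (h₁' h).1.symm
    · right; right; right; right; right; left
      exact (hext (hdiv hp₀.ne' hx) (by linarith) (by linarith)).trans (h₁' h).2.symm
    · right; right; right; right; right; right; left
      exact (hext (by linarith) (by linarith) (hdiv hr₀.ne' hz)).trans (h₂ h).1.symm
    · right; right; right; right; right; right; right; left
      exact (hext (hdiv hp₀.ne' hx) (by linarith) (by linarith)).trans (h₂ h).2.symm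
    · right; right; right; right; right; right; left
      exact (hext (hdiv' hn₁ hp₀.ne' hx) (by linarith) (hdiv' hn₁ hr₀.ne' hz)).trans
        (h₂' h).1.symm
    · right; right; right; right; right; right; right; left
      exact (hext (by linarith) (hdiv hq₀.ne' hy) (by linarith)).trans (h₂' h).2.symm
    · right; right; right; right; right; right; right; right; left
      exact (hext (by linarith) (hdiv hq₀.ne' hy) (by linarith)).trans (h₃ h).1.symm
    · right; right; right; right; right; right; right; right; right
      exact (hext (hdiv hp₀.ne' hx) (by linarith) (by linarith)).trans (h₃ h).2.symm
    · right; right; right; right; right; right; right; right; left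
      exact (hext (hdiv' hn₁ hp₀.ne' hx) (hdiv' hn₁ hq₀.ne' hy) (by linarith)).trans
        (h₃' h).1.symm
    · right; right; right; right; right; right; right; right; right
      exact (hext (by linarith) (by linarith) (hdiv hr₀.ne' hz)).trans (h₃' h).2.symm

theorem cleared_inequality_iff {n s p x b c : ℝ} (hn : 2 ≤ n) (hp : 0 < p) :
    0 ≤ (p * (n + 1) - s) / (p * (n + 1)) - n * x / (n + 1) + b / (p * (n + 1)) +
      c / (p * (n + 1)) ↔ n * (p * x) ≤ (n + 1) * p - s + b + c := by
  have hn₁ : 0 < n + 1 := by linarith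
  have h : (p * (n + 1) - s) / (p * (n + 1)) - n * x / (n + 1) + b / (p * (n + 1)) +
      c / (p * (n + 1)) = ((n + 1) * p - s + b + c - n * (p * x)) / (p * (n + 1)) := by
    field_simp; ring
  rw [h, le_div_iff₀ (mul_pos hp hn₁), zero_mul, sub_nonneg]


/-- The K-semistable domain `Kss(S_d, S_{d₁}|_{S_d}+S_{d₂}|_{S_d}+S_{d₃}|_{S_d})` in the
case `d₁ + d₂ + d₃ ≥ n + 2 - d`: the polytope `U(n,d,d₁,d₂,d₃)` equals the convex hull of
ten explicit points (the points `Aᵢ, Bᵢ` depend on whether the corresponding pairwise sum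
of degrees is `≥ n + 2 - d` or `≤ n + 2 - d`; at equality the two descriptions agree). -/
theorem kss_domain_Sd_three_divisors_ge (n d d₁ d₂ d₃ : ℕ) (hn : 2 ≤ n)
    (hd : 0 < d) (hd₁ : 0 < d₁) (hd₂ : 0 < d₂) (hd₃ : 0 < d₃)
    (hd₁' : d₁ + d ≤ n + 2) (hd₂' : d₂ + d ≤ n + 2) (hd₃' : d₃ + d ≤ n + 2)
    (hsum : n + 2 ≤ d₁ + d₂ + d₃ + d) :
    {p : ℝ × ℝ × ℝ | 0 ≤ p.1 ∧ p.1 ≤ 1 ∧ 0 ≤ p.2.1 ∧ p.2.1 ≤ 1 ∧ 0 ≤ p.2.2 ∧ p.2.2 ≤ 1 ∧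
      (d₁ : ℝ) * p.1 + (d₂ : ℝ) * p.2.1 + (d₃ : ℝ) * p.2.2 ≤ (n : ℝ) + 2 - (d : ℝ) ∧
      0 ≤ ((d₁ : ℝ) * ((n : ℝ) + 1) - ((n : ℝ) + 2 - (d : ℝ))) / ((d₁ : ℝ) * ((n : ℝ) + 1))
          - (n : ℝ) * p.1 / ((n : ℝ) + 1)
          + (d₂ : ℝ) * p.2.1 / ((d₁ : ℝ) * ((n : ℝ) + 1))
          + (d₃ : ℝ) * p.2.2 / ((d₁ : ℝ) * ((n : ℝ) + 1)) ∧
      0 ≤ ((d₂ : ℝ) * ((n : ℝ) + 1) - ((n : ℝ) + 2 - (d : ℝ))) / ((d₂ : ℝ) * ((n : ℝ) + 1))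
          - (n : ℝ) * p.2.1 / ((n : ℝ) + 1)
          + (d₁ : ℝ) * p.1 / ((d₂ : ℝ) * ((n : ℝ) + 1))
          + (d₃ : ℝ) * p.2.2 / ((d₂ : ℝ) * ((n : ℝ) + 1)) ∧
      0 ≤ ((d₃ : ℝ) * ((n : ℝ) + 1) - ((n : ℝ) + 2 - (d : ℝ))) / ((d₃ : ℝ) * ((n : ℝ) + 1))
          - (n : ℝ) * p.2.2 / ((n : ℝ) + 1)
          + (d₁ : ℝ) * p.1 / ((d₃ : ℝ) * ((n : ℝ) + 1))
          + (d₂ : ℝ) * p.2.1 / ((d₃ : ℝ) * ((n : ℝ) + 1))} =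
    convexHull ℝ
      {((0 : ℝ), (0 : ℝ), (0 : ℝ)),
       ((((n : ℝ) + 1) * (d₁ : ℝ) - ((n : ℝ) + 2 - (d : ℝ))) / ((n : ℝ) * (d₁ : ℝ)), 0, 0),
       (0, (((n : ℝ) + 1) * (d₂ : ℝ) - ((n : ℝ) + 2 - (d : ℝ))) / ((n : ℝ) * (d₂ : ℝ)), 0),
       (0, 0, (((n : ℝ) + 1) * (d₃ : ℝ) - ((n : ℝ) + 2 - (d : ℝ))) / ((n : ℝ) * (d₃ : ℝ))),
       -- A₁
       (if n + 2 ≤ d₂ + d₃ + d then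
          ((0 : ℝ), (1 : ℝ), ((n : ℝ) + 2 - (d : ℝ) - (d₂ : ℝ)) / (d₃ : ℝ))
        else
          (0, ((d₃ : ℝ) + (n : ℝ) * (d₂ : ℝ) - ((n : ℝ) + 2 - (d : ℝ))) / (((n : ℝ) - 1) * (d₂ : ℝ)),
           ((d₂ : ℝ) + (n : ℝ) * (d₃ : ℝ) - ((n : ℝ) + 2 - (d : ℝ))) / (((n : ℝ) - 1) * (d₃ : ℝ)))),
       -- B₁
       (if n + 2 ≤ d₂ + d₃ + d then
          ((0 : ℝ), ((n : ℝ) + 2 - (d : ℝ) - (d₃ : ℝ)) / (d₂ : ℝ), (1 : ℝ))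
        else
          (((n : ℝ) + 2 - (d : ℝ) - ((d₂ : ℝ) + (d₃ : ℝ))) / (d₁ : ℝ), 1, 1)),
       -- A₂
       (if n + 2 ≤ d₁ + d₃ + d then
          ((1 : ℝ), (0 : ℝ), ((n : ℝ) + 2 - (d : ℝ) - (d₁ : ℝ)) / (d₃ : ℝ))
        else
          (((d₃ : ℝ) + (n : ℝ) * (d₁ : ℝ) - ((n : ℝ) + 2 - (d : ℝ))) / (((n : ℝ) - 1) * (d₁ : ℝ)), 0,
           ((d₁ : ℝ) + (n : ℝ) * (d₃ : ℝ) - ((n : ℝ) + 2 - (d : ℝ))) / (((n : ℝ) - 1) * (d₃ : ℝ)))),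
       -- B₂
       (if n + 2 ≤ d₁ + d₃ + d then
          (((n : ℝ) + 2 - (d : ℝ) - (d₃ : ℝ)) / (d₁ : ℝ), (0 : ℝ), (1 : ℝ))
        else
          (1, ((n : ℝ) + 2 - (d : ℝ) - ((d₁ : ℝ) + (d₃ : ℝ))) / (d₂ : ℝ), 1)),
       -- A₃
       (if n + 2 ≤ d₁ + d₂ + d then
          ((1 : ℝ), ((n : ℝ) + 2 - (d : ℝ) - (d₁ : ℝ)) / (d₂ : ℝ), (0 : ℝ))
        else
          (((d₂ : ℝ) + (n : ℝ) * (d₁ : ℝ) - ((n : ℝ) + 2 - (d : ℝ))) / (((n : ℝ) - 1) * (d₁ : ℝ)),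
           ((d₁ : ℝ) + (n : ℝ) * (d₂ : ℝ) - ((n : ℝ) + 2 - (d : ℝ))) / (((n : ℝ) - 1) * (d₂ : ℝ)), 0)),
       -- B₃
       (if n + 2 ≤ d₁ + d₂ + d then
          (((n : ℝ) + 2 - (d : ℝ) - (d₂ : ℝ)) / (d₁ : ℝ), (1 : ℝ), (0 : ℝ))
        else
          (1, 1, ((n : ℝ) + 2 - (d : ℝ) - ((d₁ : ℝ) + (d₂ : ℝ))) / (d₃ : ℝ)))} := by
  have hn' : (2 : ℝ) ≤ n := by exact_mod_cast hn
  have hd' : (1 : ℝ) ≤ d := by exact_mod_cast hd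
  have hpos : ∀ e : ℕ, 0 < e → (0 : ℝ) < e := fun e he => by exact_mod_cast he
  have hlarge : ∀ e : ℕ, 0 < e → (n : ℝ) + 2 - d ≤ ((n : ℝ) + 1) * e := fun e he => by
    have : (1 : ℝ) ≤ e := by exact_mod_cast he
    nlinarith
  have hsmall : ∀ e : ℕ, e + d ≤ n + 2 → (e : ℝ) ≤ (n : ℝ) + 2 - d := fun e he => by
    have : (e : ℝ) + d ≤ n + 2 := by exact_mod_cast he
    linarith
  have hpair : ∀ e f : ℕ, n + 2 ≤ e + f + d ↔ (n : ℝ) + 2 - d ≤ (e : ℝ) + f := fun e f => by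
    rw [sub_le_iff_le_add]; norm_cast
  have hsum' : (n : ℝ) + 2 - d ≤ (d₁ : ℝ) + d₂ + d₃ := by
    rw [sub_le_iff_le_add]; exact_mod_cast hsum
  rw [← clearedPolytope_eq_convexHull_ten_points hn' (hpos _ hd₁) (hpos _ hd₂) (hpos _ hd₃)
    (hlarge _ hd₁) (hlarge _ hd₂) (hlarge _ hd₃) (hsmall _ hd₁') (hsmall _ hd₂') (hsmall _ hd₃')
    hsum'
    (fun h => ⟨if_pos ((hpair _ _).2 h), if_pos ((hpair _ _).2 h)⟩)
    (fun h => ⟨if_neg (mt (hpair _ _).1 h.not_ge), if_neg (mt (hpair _ _).1 h.not_ge)⟩)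
    (fun h => ⟨if_pos ((hpair _ _).2 h), if_pos ((hpair _ _).2 h)⟩)
    (fun h => ⟨if_neg (mt (hpair _ _).1 h.not_ge), if_neg (mt (hpair _ _).1 h.not_ge)⟩)
    (fun h => ⟨if_pos ((hpair _ _).2 h), if_pos ((hpair _ _).2 h)⟩)
    (fun h => ⟨if_neg (mt (hpair _ _).1 h.not_ge), if_neg (mt (hpair _ _).1 h.not_ge)⟩)]
  ext x
  simp only [Set.mem_ofPred_eq, cleared_inequality_iff hn' (hpos _ hd₁),
    cleared_inequality_iff hn' (hpos _ hd₂), cleared_inequality_iff hn' (hpos _ hd₃)]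
  constructor
  · rintro ⟨h₁, -, h₂, -, h₃, -, h⟩
    exact ⟨h₁, h₂, h₃, h⟩
  · intro hx
    obtain ⟨hx₁, hx₂, hx₃⟩ :=
      le_one_of_mem_clearedPolytope hn' (hpos _ hd₁) (hpos _ hd₂) (hpos _ hd₃) hx
    obtain ⟨h₁, h₂, h₃, h⟩ := hx
    exact ⟨h₁, hx₁, h₂, hx₂, h₃, hx₃, h⟩
end

section
/- Let n ≥ 2 and k ≥ 1 be integers and let d₁, …, d_k be positive integers with d₁ + … + d_k < n + 1 (so in particular k ≤ n and n - k + 1 ≥ 1). Then the system of k linear equations in real unknowns x₁, …, x_k given by (d_i - 1)/d_i - n·x_i/(n+1) + (1/(d_i(n+1)))·Σ_{j ≠ i} d_j x_j = 0 for each i = 1, …, k admits a unique solution, namely x_j = (Σ_{i ≠ j} d_i + (n-k+2)·d_j - (n+1)) / ((n-k+1)·d_j) for each j = 1, …, k. (The i-th equation is the vanishing of the beta invariant β_{ℙⁿ, Σ_j x_j S_{d_j}}(S_{d_i}) for k hypersurfaces of degrees d₁,…,d_k in ℙⁿ; the solution gives the extremal point of the K-semistable domain Kss(ℙⁿ, S_{d₁}+…+S_{d_k})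 in the interior of the simplex.) -/
/-- If `k ≠ N`, the system `N (aᵢ - 1) + Σⱼ yⱼ = N yᵢ` has the unique solution
`yᵢ = aᵢ + (Σⱼ aⱼ - N) / (N - k)`. -/
theorem forall_mul_sub_one_add_sum_eq_iff {ι K : Type*} [Fintype ι] [Field K] {N : K}
    (hN : N ≠ 0) (hNk : N - Fintype.card ι ≠ 0) (a y : ι → K) :
    (∀ i, N * (a i - 1) + ∑ j, y j = N * y i) ↔
      ∀ i, y i = a i + (∑ j, a j - N) / (N - Fintype.card ι) := by
  constructor
  · intro h
    have hS : N * (∑ j, a j - Fintype.card ι) + Fintype.card ι * ∑ j, y j = N * ∑ j, y j := by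
      have := Finset.sum_congr (rfl : (Finset.univ : Finset ι) = Finset.univ) fun i _ => h i
      simpa [Finset.sum_add_distrib, ← Finset.mul_sum, Finset.sum_sub_distrib] using this
    intro i
    apply mul_left_cancel₀ hN
    rw [← h i]
    field_simp
    linear_combination -hS
  · intro h i
    have hS : ∑ j, y j = ∑ j, a j + Fintype.card ι * ((∑ j, a j - N) / (N - Fintype.card ι)) := by
      simp [h, Finset.sum_add_distrib]
    rw [hS, h i]
    field_simp
    ring

/-- The `k × k` linear system given by the vanishing of the beta invariants
`β_{ℙⁿ, Σⱼ xⱼ S_{dⱼ}}(S_{dᵢ})` for `k` hypersurfaces of degrees `d₁, …, d_k` in `ℙⁿ`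
with `d₁ + … + d_k < n + 1` admits a unique real solution, namely
`xⱼ = (Σ_{i ≠ j} dᵢ + (n-k+2) dⱼ - (n+1)) / ((n-k+1) dⱼ)`. -/
theorem beta_system_unique_solution (n k : ℕ) (hn : 2 ≤ n) (hk : 1 ≤ k)
    (d : Fin k → ℕ) (hd : ∀ i, 0 < d i) (hsum : ∑ i, d i < n + 1) :
    ∀ x : Fin k → ℝ,
      (∀ i, ((d i : ℝ) - 1) / (d i : ℝ) - (n : ℝ) * x i / ((n : ℝ) + 1)
          + (1 / ((d i : ℝ) * ((n : ℝ) + 1))) * ∑ j ∈ Finset.univ.erase i, (d j : ℝ) * x j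
          = 0) ↔
      x = fun j => ((∑ i ∈ Finset.univ.erase j, (d i : ℝ))
            + ((n : ℝ) - (k : ℝ) + 2) * (d j : ℝ) - ((n : ℝ) + 1))
          / (((n : ℝ) - (k : ℝ) + 1) * (d j : ℝ)) := by
  intro x
  have hd0 (i) : (d i : ℝ) ≠ 0 := by exact_mod_cast (hd i).ne'
  have hN : (n : ℝ) + 1 ≠ 0 := by positivity
  have hkn : k < n + 1 := by
    refine lt_of_le_of_lt ?_ hsum
    simpa using Finset.sum_le_sum fun i (_ : i ∈ Finset.univ) => Nat.succ_le_of_lt (hd i)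
  have hnk : (n : ℝ) + 1 - k ≠ 0 := by
    have : (k : ℝ) < n + 1 := by exact_mod_cast hkn
    exact (sub_pos.mpr this).ne'
  have hnk' : (n : ℝ) - k + 1 ≠ 0 := by rwa [sub_add_eq_add_sub]
  have key := forall_mul_sub_one_add_sum_eq_iff hN (by simpa using hnk)
    (fun i => (d i : ℝ)) (fun i => (d i : ℝ) * x i)
  rw [Fintype.card_fin] at key
  rw [funext_iff]
  convert key using 2 with i i
  · rw [Finset.sum_erase_eq_sub (Finset.mem_univ i), ← sub_eq_zero (b := _ * (_ * _))]
    have h0 := hd0 i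
    rw [← mul_eq_zero_iff_left (mul_ne_zero h0 hN)]
    apply Eq.congr _ rfl
    field_simp
    ring
  · rw [Finset.sum_erase_eq_sub (Finset.mem_univ i), eq_div_iff (mul_ne_zero hnk' (hd0 i)),
      ← sub_eq_iff_eq_add', eq_div_iff hnk]
    constructor <;> intro h <;> linear_combination h
end
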